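/- arXiv:2308.11457 — 5 statements merged into one kernel-verified Lean document; each statement's English description precedes it below -/
import Mathlib

section
/- Let I, J ⊆ ℝ be nonempty open intervals, let γ, β : I → ℝ³ be smooth with β'(s) ≠ 0 for all s ∈ I (non-cylindrical), and let V ∈ ℝ³. Suppose that for every s ∈ I and every t ∈ J the ruled surface X(s,t) = γ(s) + t·β(s) is nondegenerate (EG − F² ≠ 0) and satisfies the translating soliton equation (★). Then β is not a lightlike vector field: there exists s ∈ I with ⟨β(s), β(s)⟩ ≠ 0. -/
noncomputable section

open Real

/-- The Lorentzian inner product on `𝕃³ = ℝ³`: `⟨x,y⟩ = x₁y₁ + x₂y₂ − x₃y₃`. -/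
def Lprod (u v : Fin 3 → ℝ) : ℝ := u 0 * v 0 + u 1 * v 1 - u 2 * v 2

/-- The mixed product `(u,v,w) = det(u,v,w)`. -/
def mixed (u v w : Fin 3 → ℝ) : ℝ :=
  u 0 * (v 1 * w 2 - v 2 * w 1) - u 1 * (v 0 * w 2 - v 2 * w 0) +
    u 2 * (v 0 * w 1 - v 1 * w 0)

/-- `X_s = γ' + t β'` for the ruled surface `X(s,t) = γ(s) + t β(s)`. -/
def Xs (γ β : ℝ → Fin 3 → ℝ) (s t : ℝ) : Fin 3 → ℝ := deriv γ s + t • deriv β s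

/-- `X_ss = γ'' + t β''`. -/
def Xss (γ β : ℝ → Fin 3 → ℝ) (s t : ℝ) : Fin 3 → ℝ :=
  deriv (deriv γ) s + t • deriv (deriv β) s

/-- Nondegeneracy at `(s,t)`: `EG − F² ≠ 0`. -/
def Nondeg (γ β : ℝ → Fin 3 → ℝ) (s t : ℝ) : Prop :=
  Lprod (Xs γ β s t) (Xs γ β s t) * Lprod (β s) (β s) -
      (Lprod (Xs γ β s t) (β s)) ^ 2 ≠ 0

/-- The translating soliton equation (★) of the IMCF at `(s,t)`:
`(X_s,X_t,V)·[G·(X_s,X_t,X_ss) − 2F·(X_s,X_t,X_st)] = 2(EG − F²)²`,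
where `X_t = β` and `X_st = β'`. -/
def SolitonEq (γ β : ℝ → Fin 3 → ℝ) (V : Fin 3 → ℝ) (s t : ℝ) : Prop :=
  mixed (Xs γ β s t) (β s) V *
      (Lprod (β s) (β s) * mixed (Xs γ β s t) (β s) (Xss γ β s t) -
        2 * Lprod (Xs γ β s t) (β s) * mixed (Xs γ β s t) (β s) (deriv β s)) =
    2 * (Lprod (Xs γ β s t) (Xs γ β s t) * Lprod (β s) (β s) -
          (Lprod (Xs γ β s t) (β s)) ^ 2) ^ 2

/-- Cramer's rule for four vectors of `ℝ³`, paired with a fifth one. -/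
theorem mixed_mul_Lprod (a b d v w : Fin 3 → ℝ) :
    mixed a b d * Lprod v w =
      mixed v b d * Lprod a w + mixed a v d * Lprod b w + mixed a b v * Lprod d w := by
  simp only [mixed, Lprod]; ring

theorem mixed_swap_outer (a b d : Fin 3 → ℝ) : mixed d b a = -mixed a b d := by
  simp only [mixed]; ring

/-- The Gram determinant in `𝕃³` is minus the square of the mixed product; here for a lightlike
`b` orthogonal to `d`. -/
theorem mixed_sq_of_lightlike {a b d : Fin 3 → ℝ} (hbb : Lprod b b = 0) (hbd : Lprod b d = 0) :
    mixed a b d ^ 2 = Lprod a b ^ 2 * Lprod d d := by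
  have gram : mixed a b d ^ 2 = Lprod a b ^ 2 * Lprod d d - Lprod a a * Lprod b b * Lprod d d
      + Lprod a a * Lprod b d ^ 2 + Lprod b b * Lprod a d ^ 2
      - 2 * Lprod a b * Lprod b d * Lprod a d := by
    simp only [mixed, Lprod]; ring
  rw [gram, hbb, hbd]; ring

theorem Lprod_comm (u v : Fin 3 → ℝ) : Lprod u v = Lprod v u := by
  simp only [Lprod]; ring

theorem Lprod_add_smul_left (u v w : Fin 3 → ℝ) (t : ℝ) :
    Lprod (u + t • v) w = Lprod u w + t * Lprod v w := by
  simp only [Lprod, Pi.add_apply, Pi.smul_apply, smul_eq_mul]; ring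

theorem mixed_add_smul_left (u v w x : Fin 3 → ℝ) (t : ℝ) :
    mixed (u + t • v) w x = mixed u w x + t * mixed v w x := by
  simp only [mixed, Pi.add_apply, Pi.smul_apply, smul_eq_mul]; ring

theorem mixed_self_outer (u v : Fin 3 → ℝ) : mixed u v u = 0 := by
  simp only [mixed]; ring

theorem HasDerivAt.Lprod {f g : ℝ → Fin 3 → ℝ} {f' g' : Fin 3 → ℝ} {s : ℝ}
    (hf : HasDerivAt f f' s) (hg : HasDerivAt g g' s) :
    HasDerivAt (fun r => Lprod (f r) (g r)) (Lprod f' (g s) + Lprod (f s) g') s := by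
  rw [hasDerivAt_pi] at hf hg
  simp only [_root_.Lprod]
  exact ((((hf 0).mul (hg 0)).add ((hf 1).mul (hg 1))).sub ((hf 2).mul (hg 2))).congr_deriv
    (by ring)

theorem HasDerivAt.eq_zero_of_eqOn_zero {f : ℝ → ℝ} {f' s : ℝ} {I : Set ℝ} (hI : IsOpen I)
    (hs : s ∈ I) (hf : HasDerivAt f f' s) (h : ∀ r ∈ I, f r = 0) : f' = 0 :=
  hf.unique ((hasDerivAt_const s (0 : ℝ)).congr_of_eventuallyEq
    (Filter.eventually_of_mem (hI.mem_nhds hs) h))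

/-- A nonempty open set of reals has two distinct points. -/
theorem IsOpen.exists_ne_real {J : Set ℝ} (hJ : IsOpen J) (hne : J.Nonempty) :
    ∃ t ∈ J, ∃ t' ∈ J, t ≠ t' := by
  obtain ⟨t, ht⟩ := hne
  obtain ⟨ε, hε, hball⟩ := Metric.isOpen_iff.1 hJ t ht
  refine ⟨t, ht, t + ε / 2, hball ?_, by linarith⟩
  rw [Metric.mem_ball, Real.dist_eq, add_sub_cancel_left, abs_of_pos (by linarith)]
  linarith

/-- For a lightlike director the soliton equation is affine in `t`; its coefficients. -/
theorem soliton_coeffs_of_lightlike {J : Set ℝ} (hJ : IsOpen J) (hJne : J.Nonempty)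
    {γ β : ℝ → Fin 3 → ℝ} {V : Fin 3 → ℝ} {s : ℝ}
    (hbb : Lprod (β s) (β s) = 0) (hbd : Lprod (deriv β s) (β s) = 0)
    (hnd : ∀ t ∈ J, Nondeg γ β s t) (hsol : ∀ t ∈ J, SolitonEq γ β V s t) :
    Lprod (deriv γ s) (β s) ≠ 0 ∧ mixed (deriv γ s) (β s) (deriv β s) ≠ 0 ∧
      mixed (deriv γ s) (β s) V ≠ 0 ∧ mixed (deriv β s) (β s) V = 0 := by
  have hF : Lprod (deriv γ s) (β s) ≠ 0 := by
    obtain ⟨t, ht⟩ := hJne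
    intro h
    apply hnd t ht
    simp [Xs, Lprod_add_smul_left, hbb, hbd, h]
  have key : ∀ t ∈ J, (mixed (deriv γ s) (β s) V + t * mixed (deriv β s) (β s) V) *
      mixed (deriv γ s) (β s) (deriv β s) = -Lprod (deriv γ s) (β s) ^ 3 := by
    intro t ht
    have h := hsol t ht
    simp only [SolitonEq, Xs, Lprod_add_smul_left _ _ (β s), mixed_add_smul_left,
      mixed_self_outer, hbb, hbd] at h
    apply mul_left_cancel₀ hF
    linear_combination -h / 2
  obtain ⟨t, ht, t', ht', hne⟩ := hJ.exists_ne_real hJne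
  have h := key t ht
  have hD : mixed (deriv γ s) (β s) (deriv β s) ≠ 0 := by
    intro h0
    rw [h0, mul_zero] at h
    exact pow_ne_zero 3 hF (by linarith)
  have hV : mixed (deriv β s) (β s) V = 0 := by
    apply mul_left_cancel₀ (mul_ne_zero (sub_ne_zero.2 hne) hD)
    linear_combination h - key t' ht'
  refine ⟨hF, hD, ?_, hV⟩
  intro h0
  rw [h0, hV] at h
  exact pow_ne_zero 3 hF (by linarith)

/-- For a non-cylindrical nondegenerate ruled translating soliton of the
IMCF in `𝕃³`, the director `β` is not a lightlike vector field. -/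
theorem noncylindrical_director_not_lightlike
    (I J : Set ℝ) (hIopen : IsOpen I) (hIne : I.Nonempty) (hIconn : I.OrdConnected)
    (hJopen : IsOpen J) (hJne : J.Nonempty) (hJconn : J.OrdConnected)
    (γ β : ℝ → Fin 3 → ℝ) (hγ : ContDiffOn ℝ (⊤ : ℕ∞) γ I) (hβ : ContDiffOn ℝ (⊤ : ℕ∞) β I)
    (hβ' : ∀ s ∈ I, deriv β s ≠ 0) (V : Fin 3 → ℝ)
    (hnd : ∀ s ∈ I, ∀ t ∈ J, Nondeg γ β s t)
    (hsol : ∀ s ∈ I, ∀ t ∈ J, SolitonEq γ β V s t) :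
    ∃ s ∈ I, Lprod (β s) (β s) ≠ 0 := by
  by_contra! hbb
  have hder (s) (hs : s ∈ I) : HasDerivAt β (deriv β s) s :=
    ((hβ.differentiableOn (by simp)).differentiableAt (hIopen.mem_nhds hs)).hasDerivAt
  have hdb (s) (hs : s ∈ I) : Lprod (deriv β s) (β s) = 0 := by
    have h := ((hder s hs).Lprod (hder s hs)).eq_zero_of_eqOn_zero hIopen hs hbb
    rw [Lprod_comm (β s)] at h
    linarith
  have coeffs (s) (hs : s ∈ I) :=
    soliton_coeffs_of_lightlike hJopen hJne (hbb s hs) (hdb s hs) (hnd s hs) (hsol s hs)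
  have hbV (s) (hs : s ∈ I) : Lprod (β s) V = 0 := by
    obtain ⟨-, hD, -, hV⟩ := coeffs s hs
    have h := mixed_mul_Lprod (deriv γ s) (β s) (deriv β s) V (β s)
    rw [mixed_swap_outer (deriv β s) _ V, hV, hbb s hs, hdb s hs] at h
    rw [Lprod_comm]
    simpa [hD] using h
  obtain ⟨s, hs⟩ := hIne
  obtain ⟨hF, hD, hγV, hV⟩ := coeffs s hs
  have hdV : Lprod (deriv β s) V = 0 := by
    have h := ((hder s hs).Lprod (hasDerivAt_const s V)).eq_zero_of_eqOn_zero hIopen hs hbV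
    simpa [Lprod] using h
  have hbd : Lprod (β s) (deriv β s) = 0 := by rw [Lprod_comm, hdb s hs]
  have hdd : Lprod (deriv β s) (deriv β s) ≠ 0 := by
    intro h0
    have h := mixed_sq_of_lightlike (a := deriv γ s) (hbb s hs) hbd
    rw [h0, mul_zero] at h
    exact pow_ne_zero 2 hD h
  have h := mixed_mul_Lprod (deriv γ s) (β s) (deriv β s) V (deriv β s)
  rw [mixed_swap_outer (deriv β s) _ V, hV, hbd, Lprod_comm V, hdV] at h
  simp [hγV, hdd] at h
end
end

section
/- Let I ⊆ ℝ be a nonempty open interval, let x, y : I → ℝ be smooth, let δ ∈ {−1,1} with x'(s)² − y'(s)² = δ for all s ∈ I, let v₂ ∈ ℝ with v₂ ≠ 0, let ε ∈ {−1,1}, and set v₃ = ε·v₂. Suppose that (v₂·y'(s) − v₃·x'(s))·(y'(s)·x''(s) − x'(s)·y''(s)) = 2 for all s ∈ I. Then there exist constants s₀, c₁, c₂ ∈ ℝ with s ≠ s₀ for all s ∈ I, such that for all s ∈ I: x(s) = −δ(s−s₀)²/(2v₂) − (v₂/4)·ln|s−s₀| + c₁ and y(s) = ε·(δ(s−s₀)²/(2v₂)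 − (v₂/4)·ln|s−s₀|) + c₂. -/
noncomputable section

open Real

/-- A function whose derivative on an interval agrees with that of `g` differs from `g` by a
constant there. -/
theorem exists_eq_add_const_of_hasDerivAt {I : Set ℝ} (hI : IsOpen I) (hc : I.OrdConnected)
    {f g f' : ℝ → ℝ} (hf : ∀ s ∈ I, HasDerivAt f (f' s) s)
    (hg : ∀ s ∈ I, HasDerivAt g (f' s) s) : ∃ c : ℝ, ∀ s ∈ I, f s = g s + c := by
  obtain ⟨c, h⟩ := hI.exists_eq_add_of_deriv_eq hc.isPreconnected
    (fun s hs => (hf s hs).differentiableAt.differentiableWithinAt)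
    (fun s hs => (hg s hs).differentiableAt.differentiableWithinAt)
    (fun s hs => (hf s hs).deriv.trans (hg s hs).deriv.symm)
  exact ⟨c, h⟩

theorem hasDerivAt_mul_sq_add_mul_log (a b s₀ : ℝ) {s : ℝ} (hs : s ≠ s₀) :
    HasDerivAt (fun t => a * (t - s₀) ^ 2 + b * Real.log |t - s₀|)
      (2 * a * (s - s₀) + b / (s - s₀)) s := by
  have h : HasDerivAt (fun t : ℝ => t - s₀) 1 s := (hasDerivAt_id s).sub_const s₀
  simp only [Real.log_abs]
  refine (((h.pow 2).const_mul a).add ((h.log (sub_ne_zero.2 hs)).const_mul b)).congr_deriv ?_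
  simp
  ring

theorem hasDerivAt_deriv_of_contDiffOn {I : Set ℝ} (hI : IsOpen I) {f : ℝ → ℝ}
    (hf : ContDiffOn ℝ (⊤ : ℕ∞) f I) {s : ℝ} (hs : s ∈ I) :
    HasDerivAt f (deriv f s) s ∧ HasDerivAt (deriv f) (deriv (deriv f) s) s := by
  have h1 : ContDiffOn ℝ 1 (deriv f) I := hf.deriv_of_isOpen hI (by norm_cast)
  exact ⟨((hf.differentiableOn (by simp)).differentiableAt (hI.mem_nhds hs)).hasDerivAt,
    ((h1.differentiableOn (by simp)).differentiableAt (hI.mem_nhds hs)).hasDerivAt⟩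

/-- cylindrical IMCF translating solitons with spacelike rulings and
velocity vector `V = (v₁, v₂, ±v₂)`, `v₂ ≠ 0`: explicit parametrization of the base
curve `γ(s) = (0, x(s), y(s))`. -/
theorem cylindrical_soliton_spacelike_ruling_equal_case
    (I : Set ℝ) (hIopen : IsOpen I) (hIne : I.Nonempty) (hIconn : I.OrdConnected)
    (x y : ℝ → ℝ) (hx : ContDiffOn ℝ (⊤ : ℕ∞) x I) (hy : ContDiffOn ℝ (⊤ : ℕ∞) y I)
    (δ : ℝ) (hδ : δ = -1 ∨ δ = 1)
    (harc : ∀ s ∈ I, deriv x s ^ 2 - deriv y s ^ 2 = δ)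
    (v₂ : ℝ) (hv₂ : v₂ ≠ 0) (ε : ℝ) (hε : ε = -1 ∨ ε = 1)
    (v₃ : ℝ) (hv₃ : v₃ = ε * v₂)
    (hsol : ∀ s ∈ I, (v₂ * deriv y s - v₃ * deriv x s) *
      (deriv y s * deriv (deriv x) s - deriv x s * deriv (deriv y) s) = 2) :
    ∃ s₀ c₁ c₂ : ℝ, (∀ s ∈ I, s ≠ s₀) ∧ ∀ s ∈ I,
      x s = -δ * (s - s₀) ^ 2 / (2 * v₂) - v₂ / 4 * Real.log |s - s₀| + c₁ ∧
      y s = ε * (δ * (s - s₀) ^ 2 / (2 * v₂) - v₂ / 4 * Real.log |s - s₀|) + c₂ := by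
  have hx' := fun s (hs : s ∈ I) => hasDerivAt_deriv_of_contDiffOn hIopen hx hs
  have hy' := fun s (hs : s ∈ I) => hasDerivAt_deriv_of_contDiffOn hIopen hy hs
  have hεε : ε * ε = 1 := by rcases hε with rfl | rfl <;> norm_num
  have hδδ : δ * δ = 1 := by rcases hδ with rfl | rfl <;> norm_num
  have horth : ∀ s ∈ I,
      deriv x s * deriv (deriv x) s - deriv y s * deriv (deriv y) s = 0 := by
    intro s hs
    have h := ((hx' s hs).2.pow 2).sub ((hy' s hs).2.pow 2)
    have hconst : (deriv x ^ 2 - deriv y ^ 2) =ᶠ[nhds s] fun _ => δ :=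
      Filter.eventuallyEq_of_mem (hIopen.mem_nhds hs) harc
    have h0 := h.unique ((hasDerivAt_const s δ).congr_of_eventuallyEq hconst)
    norm_num at h0
    linarith
  have hnull : ∀ s ∈ I, deriv (deriv y) s - ε * deriv (deriv x) s = 2 * ε * δ / v₂ := by
    intro s hs
    rw [eq_div_iff hv₂]
    have h1 := hsol s hs
    have h2 := horth s hs
    have h3 := harc s hs
    rw [hv₃] at h1
    have h4 : ε * δ * v₂ * (deriv (deriv y) s - ε * deriv (deriv x) s) = 2 := by
      rw [← h1, ← h3]
      rcases hε with rfl | rfl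
      · linear_combination (-v₂ * (deriv y s + deriv x s)) * h2
      · linear_combination (v₂ * (deriv y s - deriv x s)) * h2
    linear_combination ε * δ * h4 -
      (deriv (deriv y) s - ε * deriv (deriv x) s) * v₂ * (δ * δ * hεε + hδδ)
  obtain ⟨k, hk⟩ := exists_eq_add_const_of_hasDerivAt hIopen hIconn
    (f := fun s => deriv y s - ε * deriv x s) (g := fun s => 2 * ε * δ / v₂ * s)
    (f' := fun _ => 2 * ε * δ / v₂)
    (fun s hs => ((hy' s hs).2.sub ((hx' s hs).2.const_mul ε)).congr_deriv (hnull s hs))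
    (fun s _ => by simpa using (hasDerivAt_id s).const_mul (2 * ε * δ / v₂))
  obtain ⟨s₀, rfl⟩ : ∃ s₀, k = -(2 * ε * δ / v₂ * s₀) := by
    refine ⟨-(ε * δ * v₂ * k / 2), ?_⟩
    field_simp
    linear_combination -k * (δ * δ * hεε + hδδ)
  have hu : ∀ s ∈ I, deriv y s - ε * deriv x s = 2 * ε * δ / v₂ * (s - s₀) := fun s hs => by
    linear_combination hk s hs
  have huw : ∀ s ∈ I,
      2 * ε * δ / v₂ * (s - s₀) * (deriv y s + ε * deriv x s) = -δ := fun s hs => by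
    rw [← hu s hs, ← harc s hs]
    linear_combination -deriv x s ^ 2 * hεε
  have hne : ∀ s ∈ I, s ≠ s₀ := by
    rintro s hs rfl
    have h := huw s hs
    rw [sub_self, mul_zero, zero_mul] at h
    rcases hδ with rfl | rfl <;> norm_num at h
  have hw : ∀ s ∈ I, deriv y s + ε * deriv x s = -ε * v₂ / 2 / (s - s₀) := fun s hs => by
    have h0 := sub_ne_zero.2 (hne s hs)
    have h := huw s hs
    field_simp at h ⊢
    linear_combination ε * δ * h -
      (2 * (s - s₀) * (deriv y s + ε * deriv x s)) * (δ * δ * hεε + hδδ) - ε * v₂ * hδδ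
  obtain ⟨c₁, hc₁⟩ := exists_eq_add_const_of_hasDerivAt hIopen hIconn
    (fun s hs => (hx' s hs).1)
    (fun s hs => (hasDerivAt_mul_sq_add_mul_log (-δ / (2 * v₂)) (-v₂ / 4) s₀
      (hne s hs)).congr_deriv (by
        have h0 := sub_ne_zero.2 (hne s hs)
        have hp : deriv x s =
            ε / 2 * (-ε * v₂ / 2 / (s - s₀) - 2 * ε * δ / v₂ * (s - s₀)) := by
          rw [← hu s hs, ← hw s hs]
          linear_combination -deriv x s * hεε
        rw [hp]
        linear_combination (v₂ / 4 / (s - s₀) + δ / v₂ * (s - s₀)) * hεε))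
  obtain ⟨c₂, hc₂⟩ := exists_eq_add_const_of_hasDerivAt hIopen hIconn
    (fun s hs => (hy' s hs).1)
    (fun s hs => (hasDerivAt_mul_sq_add_mul_log (ε * δ / (2 * v₂)) (-ε * v₂ / 4) s₀
      (hne s hs)).congr_deriv (by linear_combination (-1 / 2) * (hu s hs + hw s hs)))
  refine ⟨s₀, c₁, c₂, hne, fun s hs => ⟨?_, ?_⟩⟩
  · rw [hc₁ s hs]
    ring
  · rw [hc₂ s hs]
    ring
end
end

section
/- Let I ⊆ ℝ be a nonempty open interval, let x, y : I → ℝ be smooth with x'(s)² + y'(s)² = 1 for all s ∈ I, and let v₁, v₂ ∈ ℝ. Suppose that (v₁·y'(s) − v₂·x'(s))·(y'(s)·x''(s) − x'(s)·y''(s)) = −2 for all s ∈ I. Then (v₁,v₂) ≠ (0,0), and there exist s₀, c₁, c₂ ∈ ℝ and ε, ε' ∈ {−1,1} such that for all s ∈ I one has 4(s−s₀)² ≤ v₁² + v₂² and, writing R(s) = √((v₁² + v₂²)/4 − (s−s₀)²): x(s) = −v₁(s−s₀)²/(v₁²+v₂²) − ε·(|v₂|/4)·arccos(2(s−s₀)/√(v₁²+v₂²))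 + ε·|v₂|·(s−s₀)·R(s)/(v₁²+v₂²) + c₁ and y(s) = −v₂(s−s₀)²/(v₁²+v₂²) + ε'·(|v₁|/4)·arccos(2(s−s₀)/√(v₁²+v₂²)) − ε'·|v₁|·(s−s₀)·R(s)/(v₁²+v₂²) + c₂. -/
noncomputable section

open Real

/-- A function with vanishing derivative on an open order-connected set of reals is constant
there. -/
theorem exists_const_of_hasDerivAt_zero {I : Set ℝ} (hIopen : IsOpen I) (hIconn : I.OrdConnected)
    {f : ℝ → ℝ} (hf : ∀ s ∈ I, HasDerivAt f 0 s) : ∃ c, ∀ s ∈ I, f s = c :=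
  hIopen.exists_is_const_of_deriv_eq_zero hIconn.isPreconnected
    (fun s hs => (hf s hs).differentiableAt.differentiableWithinAt)
    (fun s hs => (hf s hs).deriv)

/-- The explicit primitive of `-2 √(w / 4 - (s - s₀)²) / w`. -/
theorem hasDerivAt_arccos_sub_mul_sqrt {w s₀ s : ℝ} (h : 4 * (s - s₀) ^ 2 < w) :
    HasDerivAt (fun s => Real.arccos (2 * (s - s₀) / Real.sqrt w) / 4 -
      (s - s₀) * Real.sqrt (w / 4 - (s - s₀) ^ 2) / w)
      (-(2 * Real.sqrt (w / 4 - (s - s₀) ^ 2) / w)) s := by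
  have hw : 0 < w := lt_of_le_of_lt (by positivity) h
  have hR0 : 0 < w / 4 - (s - s₀) ^ 2 := by linarith
  have hR : 0 < Real.sqrt (w / 4 - (s - s₀) ^ 2) := Real.sqrt_pos.mpr hR0
  have hRsq : Real.sqrt (w / 4 - (s - s₀) ^ 2) ^ 2 = w / 4 - (s - s₀) ^ 2 := Real.sq_sqrt hR0.le
  have hW : 0 < Real.sqrt w := Real.sqrt_pos.mpr hw
  have hWsq : Real.sqrt w ^ 2 = w := Real.sq_sqrt hw.le
  have hlt : (2 * (s - s₀) / Real.sqrt w) ^ 2 < 1 := by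
    rw [div_pow, hWsq, div_lt_one hw]
    linarith
  have habs := abs_lt.mp ((sq_lt_one_iff_abs_lt_one _).mp hlt)
  have hu : HasDerivAt (fun s => s - s₀) 1 s := (hasDerivAt_id s).sub_const s₀
  have harg : HasDerivAt (fun s => 2 * (s - s₀) / Real.sqrt w) (2 * 1 / Real.sqrt w) s :=
    (hu.const_mul 2).div_const _
  have hacos := (Real.hasDerivAt_arccos habs.1.ne' habs.2.ne).comp s harg
  have hroot : Real.sqrt (1 - (2 * (s - s₀) / Real.sqrt w) ^ 2) =
      2 * Real.sqrt (w / 4 - (s - s₀) ^ 2) / Real.sqrt w := by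
    rw [Real.sqrt_eq_iff_mul_self_eq_of_pos (by positivity), ← sq, div_pow, mul_pow, hRsq, div_pow,
      hWsq]
    field_simp
    ring
  have hsqrt := ((hu.pow 2).const_sub (w / 4)).sqrt hR0.ne'
  have hmain := (hacos.div_const 4).sub ((hu.mul hsqrt).div_const w)
  refine hmain.congr_deriv ?_
  rw [hroot]
  simp only [Pi.pow_apply]
  set R := Real.sqrt (w / 4 - (s - s₀) ^ 2)
  have hww : w = 4 * R ^ 2 + 4 * (s - s₀) ^ 2 := by linarith
  field_simp
  rw [hww]
  ring

/-- For a sign `σ`, a real number is a signed multiple of its absolute value. -/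
theorem exists_sign_mul_abs_eq_neg_mul {σ : ℝ} (hσ : σ = -1 ∨ σ = 1) (v : ℝ) :
    ∃ ε : ℝ, (ε = -1 ∨ ε = 1) ∧ ε * |v| = -σ * v := by
  rcases abs_choice v with h | h
  · exact ⟨-σ, by rcases hσ with rfl | rfl <;> simp, by rw [h]⟩
  · exact ⟨σ, hσ, by rw [h]; ring⟩

/-- cylindrical IMCF translating solitons with timelike rulings:
explicit "cycloidal" parametrization of the base curve `γ(s) = (x(s), y(s), 0)`. -/
theorem cylindrical_soliton_timelike_ruling
    (I : Set ℝ) (hIopen : IsOpen I) (hIne : I.Nonempty) (hIconn : I.OrdConnected)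
    (x y : ℝ → ℝ) (hx : ContDiffOn ℝ (⊤ : ℕ∞) x I) (hy : ContDiffOn ℝ (⊤ : ℕ∞) y I)
    (harc : ∀ s ∈ I, deriv x s ^ 2 + deriv y s ^ 2 = 1)
    (v₁ v₂ : ℝ)
    (hsol : ∀ s ∈ I, (v₁ * deriv y s - v₂ * deriv x s) *
      (deriv y s * deriv (deriv x) s - deriv x s * deriv (deriv y) s) = -2) :
    (v₁, v₂) ≠ (0, 0) ∧
    ∃ (s₀ c₁ c₂ ε ε' : ℝ), (ε = -1 ∨ ε = 1) ∧ (ε' = -1 ∨ ε' = 1) ∧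
      ∀ s ∈ I, 4 * (s - s₀) ^ 2 ≤ v₁ ^ 2 + v₂ ^ 2 ∧
        x s = -v₁ * (s - s₀) ^ 2 / (v₁ ^ 2 + v₂ ^ 2) -
            ε * (|v₂| / 4) * Real.arccos (2 * (s - s₀) / Real.sqrt (v₁ ^ 2 + v₂ ^ 2)) +
            ε * |v₂| * (s - s₀) *
              Real.sqrt ((v₁ ^ 2 + v₂ ^ 2) / 4 - (s - s₀) ^ 2) / (v₁ ^ 2 + v₂ ^ 2) +
            c₁ ∧
        y s = -v₂ * (s - s₀) ^ 2 / (v₁ ^ 2 + v₂ ^ 2) +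
            ε' * (|v₁| / 4) * Real.arccos (2 * (s - s₀) / Real.sqrt (v₁ ^ 2 + v₂ ^ 2)) -
            ε' * |v₁| * (s - s₀) *
              Real.sqrt ((v₁ ^ 2 + v₂ ^ 2) / 4 - (s - s₀) ^ 2) / (v₁ ^ 2 + v₂ ^ 2) +
            c₂ := by
  have hpre : IsPreconnected I := hIconn.isPreconnected
  have hder : ∀ {f : ℝ → ℝ}, ContDiffOn ℝ (⊤ : ℕ∞) f I → ∀ s ∈ I,
      HasDerivAt f (deriv f s) s ∧ HasDerivAt (deriv f) (deriv (deriv f) s) s := by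
    intro f hf s hs
    have hnhds := hIopen.mem_nhds hs
    have hf' := ((contDiffOn_infty_iff_deriv_of_isOpen hIopen).mp hf).2
    exact ⟨((hf.differentiableOn (by simp)).differentiableAt hnhds).hasDerivAt,
      ((hf'.differentiableOn (by simp)).differentiableAt hnhds).hasDerivAt⟩
  obtain ⟨a, ha⟩ := hIne
  have hv : (v₁, v₂) ≠ (0, 0) := by
    rintro h
    obtain ⟨rfl, rfl⟩ := Prod.mk.inj h
    have := hsol a ha
    norm_num at this
  have hB : ∀ s ∈ I, HasDerivAt
      (fun s => v₁ * deriv x s + v₂ * deriv y s + 2 * s) 0 s := by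
    intro s hs
    have hp := (hder hx s hs).2
    have hq := (hder hy s hs).2
    have hunit : deriv x s * deriv (deriv x) s + deriv y s * deriv (deriv y) s = 0 := by
      have h1 := (hp.pow 2).add (hq.pow 2)
      have h2 : (deriv x ^ 2 + deriv y ^ 2) =ᶠ[nhds s] fun _ => 1 := by
        filter_upwards [hIopen.mem_nhds hs] with t ht using harc t ht
      have h3 := h1.unique ((hasDerivAt_const s (1 : ℝ)).congr_of_eventuallyEq h2)
      norm_num at h3
      linarith
    refine (((hp.const_mul v₁).add (hq.const_mul v₂)).add
      ((hasDerivAt_id s).const_mul 2)).congr_deriv ?_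
    linear_combination hsol s hs
      - (v₁ * deriv (deriv x) s + v₂ * deriv (deriv y) s) * harc s hs
      + (v₁ * deriv x s + v₂ * deriv y s) * hunit
  obtain ⟨b, hb⟩ := exists_const_of_hasDerivAt_zero hIopen hIconn hB
  obtain ⟨w, hw⟩ : ∃ w, w = v₁ ^ 2 + v₂ ^ 2 := ⟨_, rfl⟩
  obtain ⟨s₀, hs₀⟩ : ∃ s₀, b = 2 * s₀ := ⟨b / 2, by ring⟩
  have hA : ∀ s ∈ I,
      (v₁ * deriv y s - v₂ * deriv x s) ^ 2 = w - 4 * (s - s₀) ^ 2 := by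
    intro s hs
    have h1 : v₁ * deriv x s + v₂ * deriv y s = -2 * (s - s₀) := by linarith [hb s hs]
    rw [hw]
    linear_combination (v₁ ^ 2 + v₂ ^ 2) * harc s hs -
      (v₁ * deriv x s + v₂ * deriv y s - 2 * (s - s₀)) * h1
  have hlt : ∀ s ∈ I, 4 * (s - s₀) ^ 2 < w := by
    intro s hs
    have h0 : v₁ * deriv y s - v₂ * deriv x s ≠ 0 := by
      intro h
      have := hsol s hs
      rw [h] at this
      norm_num at this
    have := hA s hs
    have : 0 < (v₁ * deriv y s - v₂ * deriv x s) ^ 2 := by positivity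
    linarith
  have hw0 : 0 < w := lt_of_le_of_lt (by positivity) (hlt a ha)
  have hsign : ∃ σ : ℝ, (σ = -1 ∨ σ = 1) ∧ ∀ s ∈ I, v₁ * deriv y s - v₂ * deriv x s =
      σ * (2 * Real.sqrt (w / 4 - (s - s₀) ^ 2)) := by
    have hcont : ContinuousOn (fun s => v₁ * deriv y s - v₂ * deriv x s) I := fun s hs =>
      (((hder hy s hs).2.const_mul v₁).sub
        ((hder hx s hs).2.const_mul v₂)).continuousAt.continuousWithinAt
    have hcont' : ContinuousOn (fun s => 2 * Real.sqrt (w / 4 - (s - s₀) ^ 2)) I := by fun_prop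
    rcases hpre.eq_or_eq_neg_of_sq_eq hcont hcont'
      (fun s hs => by
        have := Real.sq_sqrt (show 0 ≤ w / 4 - (s - s₀) ^ 2 by linarith [hlt s hs])
        simp only [Pi.pow_apply, mul_pow]
        rw [this, hA s hs]
        ring)
      (fun {s} hs => by
        have := Real.sqrt_pos.mpr (show 0 < w / 4 - (s - s₀) ^ 2 by linarith [hlt s hs])
        positivity) with h | h
    · exact ⟨1, Or.inr rfl, fun s hs => by simpa using h hs⟩
    · exact ⟨-1, Or.inl rfl, fun s hs => by simpa using h hs⟩
  obtain ⟨σ, hσ, hAσ⟩ := hsign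
  obtain ⟨ε, hε, hεv⟩ := exists_sign_mul_abs_eq_neg_mul hσ v₂
  obtain ⟨ε', hε', hεv'⟩ := exists_sign_mul_abs_eq_neg_mul hσ v₁
  have hsq : ∀ s, HasDerivAt (fun s => (s - s₀) ^ 2 / w) (2 * (s - s₀) / w) s := by
    intro s
    refine ((((hasDerivAt_id s).sub_const s₀).pow 2).div_const w).congr_deriv ?_
    simp
  obtain ⟨c₁, hc₁⟩ := exists_const_of_hasDerivAt_zero hIopen hIconn fun s hs =>
    (((hder hx s hs).1.add ((hsq s).const_mul v₁)).add
      ((hasDerivAt_arccos_sub_mul_sqrt (hlt s hs)).const_mul (ε * |v₂|))).congr_deriv (by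
        rw [hεv]
        have hσs := hAσ s hs
        generalize Real.sqrt (w / 4 - (s - s₀) ^ 2) = r at hσs ⊢
        field_simp
        rw [hw]
        linear_combination v₁ * hb s hs + v₁ * hs₀ - v₂ * hσs)
  obtain ⟨c₂, hc₂⟩ := exists_const_of_hasDerivAt_zero hIopen hIconn fun s hs =>
    (((hder hy s hs).1.add ((hsq s).const_mul v₂)).sub
      ((hasDerivAt_arccos_sub_mul_sqrt (hlt s hs)).const_mul (ε' * |v₁|))).congr_deriv (by
        rw [hεv']
        have hσs := hAσ s hs
        generalize Real.sqrt (w / 4 - (s - s₀) ^ 2) = r at hσs ⊢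
        field_simp
        rw [hw]
        linear_combination v₂ * hb s hs + v₂ * hs₀ + v₁ * hσs)
  refine ⟨hv, s₀, c₁, c₂, ε, ε', hε, hε', fun s hs => ?_⟩
  rw [← hw]
  have h₁ := hc₁ s hs
  have h₂ := hc₂ s hs
  simp only [Pi.add_apply, Pi.sub_apply] at h₁ h₂
  exact ⟨(hlt s hs).le, by linear_combination h₁, by linear_combination h₂⟩
end
end

section
/- Let I ⊆ ℝ be a nonempty open interval, let x, y : I → ℝ be smooth, let δ ∈ {−1,1} with x'(s)² − y'(s)² = δ for all s ∈ I, and let v₂, v₃ ∈ ℝ. Suppose that (v₂·y'(s) − v₃·x'(s))·(y'(s)·x''(s) − x'(s)·y''(s)) = 2 for all s ∈ I. Then for all s ∈ I: x''(s) = −2δ·y'(s)/(v₂·y'(s) − v₃·x'(s)), y''(s) = −2δ·x'(s)/(v₂·y'(s) − v₃·x'(s)), and v₃·y''(s) − v₂·x''(s) = 2δ. -/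
noncomputable section

open Real

/-- second-derivative formulas for cylindrical IMCF translating solitons
with spacelike rulings. -/
theorem cylindrical_soliton_spacelike_second_derivatives
    (I : Set ℝ) (hIopen : IsOpen I) (hIne : I.Nonempty) (hIconn : I.OrdConnected)
    (x y : ℝ → ℝ) (hx : ContDiffOn ℝ (⊤ : ℕ∞) x I) (hy : ContDiffOn ℝ (⊤ : ℕ∞) y I)
    (δ : ℝ) (hδ : δ = -1 ∨ δ = 1)
    (harc : ∀ s ∈ I, deriv x s ^ 2 - deriv y s ^ 2 = δ)
    (v₂ v₃ : ℝ)
    (hsol : ∀ s ∈ I, (v₂ * deriv y s - v₃ * deriv x s) *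
      (deriv y s * deriv (deriv x) s - deriv x s * deriv (deriv y) s) = 2) :
    ∀ s ∈ I,
      deriv (deriv x) s = -2 * δ * deriv y s / (v₂ * deriv y s - v₃ * deriv x s) ∧
      deriv (deriv y) s = -2 * δ * deriv x s / (v₂ * deriv y s - v₃ * deriv x s) ∧
      v₃ * deriv (deriv y) s - v₂ * deriv (deriv x) s = 2 * δ := by
  intro s hs
  have hdiff : ∀ f : ℝ → ℝ, ContDiffOn ℝ (⊤ : ℕ∞) f I → DifferentiableAt ℝ (deriv f) s :=
    fun f hf ↦ (((contDiffOn_infty_iff_deriv_of_isOpen hIopen).1 hf).2.differentiableOn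
      (by simp)).differentiableAt (hIopen.mem_nhds hs)
  have horth : deriv x s * deriv (deriv x) s = deriv y s * deriv (deriv y) s := by
    have hconst : (fun t ↦ deriv x t ^ 2 - deriv y t ^ 2) =ᶠ[nhds s] fun _ ↦ δ :=
      Filter.eventually_of_mem (hIopen.mem_nhds hs) harc
    have hderiv := ((hdiff x hx).hasDerivAt.fun_pow 2).fun_sub ((hdiff y hy).hasDerivAt.fun_pow 2)
    have h := hderiv.unique ((hasDerivAt_const s δ).congr_of_eventuallyEq hconst)
    norm_num at h
    linarith
  have harcs := harc s hs
  have hsols := hsol s hs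
  have hδ2 : δ ^ 2 = 1 := by rcases hδ with rfl | rfl <;> norm_num
  generalize deriv (deriv x) s = p' at *
  generalize deriv (deriv y) s = q' at *
  generalize deriv x s = p at *
  generalize deriv y s = q at *
  have hD : v₂ * q - v₃ * p ≠ 0 := by
    intro h
    simp [h] at hsols
  have hp' : p' = -δ * q * (q * p' - p * q') := by
    linear_combination (-p') * hδ2 + δ * p' * harcs.symm + δ * p * horth
  have hq' : q' = -δ * p * (q * p' - p * q') := by
    linear_combination (-q') * hδ2 + δ * q' * harcs.symm + δ * q * horth
  refine ⟨?_, ?_, ?_⟩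
  · rw [eq_div_iff hD]
    linear_combination (v₂ * q - v₃ * p) * hp' - δ * q * hsols
  · rw [eq_div_iff hD]
    linear_combination (v₂ * q - v₃ * p) * hq' - δ * p * hsols
  · linear_combination v₃ * hq' - v₂ * hp' + δ * hsols
end
end

section
/- Let I ⊆ ℝ be a nonempty open interval and let β : I → ℝ³ be a smooth curve with ⟨β(s), β(s)⟩ = 1 for all s ∈ I, β'(s) ≠ 0 for all s ∈ I, and ⟨β'(s), β'(s)⟩ = 0 for all s ∈ I (i.e. β is a curve in the de Sitter surface {x ∈ 𝕃³ : ⟨x,x⟩ = 1} whose tangent vector is everywhere lightlike). Then the trace of β lies on a straight line with lightlike direction: there exist vectors a, b ∈ ℝ³ with a ≠ 0, ⟨a,a⟩ = 0, ⟨a,b⟩ = 0, ⟨b,b⟩ = 1 and a smooth function f : I → ℝ with f'(s) ≠ 0 for all s, such that β(s) = b + f(s)·a for all s ∈ I. -/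
noncomputable section

open Real

/-- On an interval, a function with vanishing derivative is constant. -/
theorem eq_of_hasDerivAt_zero_of_ordConnected {I : Set ℝ} (hIopen : IsOpen I)
    (hIconn : I.OrdConnected) {g : ℝ → ℝ} (hg : ∀ s ∈ I, HasDerivAt g 0 s)
    {s t : ℝ} (hs : s ∈ I) (ht : t ∈ I) : g s = g t :=
  hIopen.is_const_of_deriv_eq_zero hIconn.isPreconnected
    (fun r hr => (hg r hr).differentiableAt.differentiableWithinAt)
    (fun r hr => (hg r hr).deriv) hs ht

/-- The derivative of a function constant on an open set vanishes there. -/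
theorem hasDerivAt_eq_zero_of_eqOn_const {I : Set ℝ} (hIopen : IsOpen I) {g : ℝ → ℝ} {c g' s : ℝ}
    (hg : ∀ r ∈ I, g r = c) (hs : s ∈ I) (h : HasDerivAt g g' s) : g' = 0 := by
  have hc : HasDerivAt g 0 s := (hasDerivAt_const s c).congr_of_eventuallyEq
    (Filter.eventually_of_mem (hIopen.mem_nhds hs) hg)
  exact h.unique hc

/-- A nonzero lightlike vector has nonzero time coordinate. -/
theorem time_coord_ne_zero_of_lightlike {v : Fin 3 → ℝ} (hv : v ≠ 0) (hl : Lprod v v = 0) :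
    v 2 ≠ 0 := by
  intro h
  apply hv
  unfold Lprod at hl
  rw [h] at hl
  have h0 : v 0 = 0 := by nlinarith [sq_nonneg (v 0), sq_nonneg (v 1)]
  have h1 : v 1 = 0 := by nlinarith [sq_nonneg (v 0), sq_nonneg (v 1)]
  ext i
  fin_cases i <;> simp [h0, h1, h]

/-- a curve in the de Sitter surface `{⟨x,x⟩ = 1}` of `𝕃³` whose tangent
vector is everywhere lightlike lies on a straight line with lightlike direction. -/
theorem deSitter_lightlike_tangent_curve_is_line
    (I : Set ℝ) (hIopen : IsOpen I) (hIne : I.Nonempty) (hIconn : I.OrdConnected)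
    (β : ℝ → Fin 3 → ℝ) (hβ : ContDiffOn ℝ (⊤ : ℕ∞) β I)
    (hunit : ∀ s ∈ I, Lprod (β s) (β s) = 1)
    (hreg : ∀ s ∈ I, deriv β s ≠ 0)
    (hlight : ∀ s ∈ I, Lprod (deriv β s) (deriv β s) = 0) :
    ∃ (a b : Fin 3 → ℝ) (f : ℝ → ℝ), a ≠ 0 ∧ Lprod a a = 0 ∧ Lprod a b = 0 ∧
      Lprod b b = 1 ∧ ContDiffOn ℝ (⊤ : ℕ∞) f I ∧ (∀ s ∈ I, deriv f s ≠ 0) ∧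
      ∀ s ∈ I, β s = b + f s • a := by
  obtain ⟨s₀, hs₀⟩ := hIne
  have htime : ∀ s ∈ I, deriv β s 2 ≠ 0 := fun s hs =>
    time_coord_ne_zero_of_lightlike (hreg s hs) (hlight s hs)
  have hd : ∀ s ∈ I, ∀ i, HasDerivAt (fun t => β t i) (deriv β s i) s := fun s hs =>
    hasDerivAt_pi.1 ((hβ.contDiffAt (hIopen.mem_nhds hs)).differentiableAt (by simp)).hasDerivAt
  have hβ' : ContDiffOn ℝ 1 (deriv β) I := hβ.deriv_of_isOpen hIopen
    (WithTop.coe_le_coe.2 (le_top : (1 + 1 : ℕ∞) ≤ ⊤))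
  have hdd : ∀ s ∈ I, ∀ i, HasDerivAt (fun t => deriv β t i) (deriv (deriv β) s i) s :=
    fun s hs => hasDerivAt_pi.1
      ((hβ'.contDiffAt (hIopen.mem_nhds hs)).differentiableAt (by simp)).hasDerivAt
  set w : Fin 3 → ℝ → ℝ := fun i t => deriv β t i / deriv β t 2 with hw
  have hw2 : ∀ s ∈ I, w 2 s = 1 := fun s hs => div_self (htime s hs)
  have hv : ∀ s ∈ I, ∀ i, deriv β s i = w i s * deriv β s 2 := fun s hs i =>
    (div_mul_cancel₀ _ (htime s hs)).symm
  have hwnull : ∀ s ∈ I, w 0 s * w 0 s + w 1 s * w 1 s = 1 := by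
    intro s hs
    have h := hlight s hs
    have h2 := htime s hs
    simp only [Lprod] at h
    simp only [hw]
    field_simp
    linarith
  have horth : ∀ s ∈ I, β s 0 * w 0 s + β s 1 * w 1 s - β s 2 = 0 := by
    intro s hs
    have h := hasDerivAt_eq_zero_of_eqOn_const hIopen hunit hs
      ((((hd s hs 0).mul (hd s hs 0)).add ((hd s hs 1).mul (hd s hs 1))).sub
        ((hd s hs 2).mul (hd s hs 2)))
    have h2 := htime s hs
    rw [hv s hs 0, hv s hs 1] at h
    refine (mul_eq_zero.1 ?_).resolve_left h2
    linarith
  have hwd : ∀ s ∈ I, ∀ i, ∃ d, HasDerivAt (w i) d s := fun s hs i =>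
    ⟨_, (hdd s hs i).div (hdd s hs 2) (htime s hs)⟩
  have hwzero : ∀ s ∈ I, HasDerivAt (w 0) 0 s ∧ HasDerivAt (w 1) 0 s := by
    intro s hs
    obtain ⟨p', hp⟩ := hwd s hs 0
    obtain ⟨q', hq⟩ := hwd s hs 1
    have e1 := hasDerivAt_eq_zero_of_eqOn_const hIopen hwnull hs ((hp.mul hp).add (hq.mul hq))
    have e2 := hasDerivAt_eq_zero_of_eqOn_const hIopen horth hs
      ((((hd s hs 0).mul hp).add ((hd s hs 1).mul hq)).sub (hd s hs 2))
    have hn := hwnull s hs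
    have ho := horth s hs
    have hu := hunit s hs
    simp only [Lprod] at hu
    rw [hv s hs 0, hv s hs 1] at e2
    have e3 : β s 0 * p' + β s 1 * q' = 0 := by linear_combination e2 - deriv β s 2 * hn
    have e4 : w 0 s * p' + w 1 s * q' = 0 := by linarith
    have hD : w 0 s * β s 1 - w 1 s * β s 0 ≠ 0 := by
      intro h
      have : (w 0 s * β s 1 - w 1 s * β s 0) ^ 2 = 1 := by
        linear_combination (β s 0 ^ 2 + β s 1 ^ 2) * hn + hu
          - (β s 0 * w 0 s + β s 1 * w 1 s + β s 2) * ho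
      rw [h] at this
      norm_num at this
    have hp0 : p' = 0 := by
      refine (mul_eq_zero.1 ?_).resolve_left hD
      linear_combination β s 1 * e4 - w 1 s * e3
    have hq0 : q' = 0 := by
      refine (mul_eq_zero.1 ?_).resolve_left hD
      linear_combination w 0 s * e3 - β s 0 * e4
    exact ⟨hp0 ▸ hp, hq0 ▸ hq⟩
  have hwconst : ∀ s ∈ I, ∀ i, w i s = w i s₀ := by
    intro s hs i
    fin_cases i
    · exact eq_of_hasDerivAt_zero_of_ordConnected hIopen hIconn (fun r hr => (hwzero r hr).1) hs hs₀
    · exact eq_of_hasDerivAt_zero_of_ordConnected hIopen hIconn (fun r hr => (hwzero r hr).2) hs hs₀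
    · exact (hw2 s hs).trans (hw2 s₀ hs₀).symm
  have hline : ∀ s ∈ I, ∀ i, β s i - β s 2 * w i s₀ = β s₀ i - β s₀ 2 * w i s₀ := by
    intro s hs i
    refine eq_of_hasDerivAt_zero_of_ordConnected hIopen hIconn
      (g := fun t => β t i - β t 2 * w i s₀) (fun r hr => ?_) hs hs₀
    have hzero : deriv β r i - deriv β r 2 * w i s₀ = 0 := by
      rw [hv r hr i, hwconst r hr i]
      ring
    exact hzero ▸ (hd r hr i).sub ((hd r hr 2).mul_const (w i s₀))
  have hn := hwnull s₀ hs₀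
  have ho := horth s₀ hs₀
  have hu := hunit s₀ hs₀
  have h1 := hw2 s₀ hs₀
  simp only [Lprod] at hu
  refine ⟨fun i => w i s₀, fun i => β s₀ i - β s₀ 2 * w i s₀, fun s => β s 2, ?_, ?_, ?_, ?_,
    contDiffOn_pi.1 hβ 2, fun s hs => ?_, fun s hs => ?_⟩
  · intro h
    have := congrFun h 2
    simp [h1] at this
  · simp only [Lprod, h1]
    linarith
  · simp only [Lprod, h1]
    linear_combination ho - β s₀ 2 * hn
  · simp only [Lprod, h1]
    linear_combination hu - 2 * β s₀ 2 * ho + β s₀ 2 ^ 2 * hn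
  · rw [(hd s hs 2).deriv]
    exact htime s hs
  · ext i
    have := hline s hs i
    simp only [Pi.add_apply, Pi.smul_apply, smul_eq_mul]
    linarith
end
end
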